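/- arXiv:1612.03191 — 3 statements merged into one kernel-verified Lean document; each statement's English description precedes it below -/
import Mathlib

section
/- (Characterisation of the classical must preorder, De Nicola–Hennessy) For all processes p and q: p ⊑_must q if and only if p ≼_must q, where p ≼_must q means: for every string s ∈ Act* and every finite set L ⊆ Act, if p ⇓ s then (i) q ⇓ s and (ii) (p after s) MUST L implies (q after s) MUST L. -/
/-!
Common definitions: sequential CCS with success, configurations,
must testing, Mazurkiewicz traces, filtered traces, interfaces, and
the classical / uncoordinated / individualistic must preorders.
-/

namespace MultipartyTesting

/-- Actions: input or output over a name. -/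
inductive Act (Name : Type) : Type where
  | inp : Name → Act Name
  | out : Name → Act Name

/-- Complementation of actions (involutive). -/
def Act.co {Name : Type} : Act Name → Act Name
  | .inp a => .out a
  | .out a => .inp a

/-- Transition labels: visible actions, the internal action τ, and success ✓. -/
inductive Label (Name : Type) : Type where
  | act : Act Name → Label Name
  | tau : Label Name
  | tick : Label Name

/-- Sequential CCS with success (recursion via de Bruijn indices):
`p ::= 0 | 1 | μ.p | p+q | X | rec_X. p` where prefixes are actions (`pre`) or τ (`tpre`). -/
inductive Proc (Name : Type) : Type where
  | nil : Proc Name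
  | one : Proc Name
  | pre : Act Name → Proc Name → Proc Name
  | tpre : Proc Name → Proc Name
  | choice : Proc Name → Proc Name → Proc Name
  | var : ℕ → Proc Name
  | fix : Proc Name → Proc Name

namespace Proc

variable {Name : Type}

/-- de Bruijn lifting. -/
def lift (d : ℕ) : Proc Name → Proc Name
  | nil => nil
  | one => one
  | pre a p => pre a (lift d p)
  | tpre p => tpre (lift d p)
  | choice p q => choice (lift d p) (lift d q)
  | var k => if k < d then var k else var (k + 1)
  | fix p => fix (lift (d + 1) p)

/-- Substitution of `u` for de Bruijn index `d`. -/
def subst (d : ℕ) (u : Proc Name) : Proc Name → Proc Name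
  | nil => nil
  | one => one
  | pre a p => pre a (subst d u p)
  | tpre p => tpre (subst d u p)
  | choice p q => choice (subst d u p) (subst d u q)
  | var k => if k = d then u else if k < d then var k else var (k - 1)
  | fix p => fix (subst (d + 1) (lift 0 u) p)

/-- The set of actions occurring in a process (so `α` or `ᾱ` occurs in `p`
iff the corresponding name is in `n(p)`). -/
def acts : Proc Name → Set (Act Name)
  | nil => ∅
  | one => ∅
  | pre a p => insert a (acts p)
  | tpre p => acts p
  | choice p q => acts p ∪ acts q
  | var _ => ∅
  | fix p => acts p

end Proc

/-- The LTS on sequential processes. -/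
inductive Step {Name : Type} : Proc Name → Label Name → Proc Name → Prop where
  | one : Step Proc.one Label.tick Proc.nil
  | pre (a : Act Name) (p : Proc Name) : Step (Proc.pre a p) (Label.act a) p
  | tpre (p : Proc Name) : Step (Proc.tpre p) Label.tau p
  | choiceL {p l p'} (q) : Step p l p' → Step (Proc.choice p q) l p'
  | choiceR {q l q'} (p) : Step q l q' → Step (Proc.choice p q) l q'
  | fix {p l p'} : Step (Proc.subst 0 (Proc.fix p) p) l p' → Step (Proc.fix p) l p'

/-- Configurations: parallel compositions of processes; additionally
`hide V c` is the projection `c↾V` that hides (turns into τ) every action not in `V`. -/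
inductive Conf (Name : Type) : Type where
  | proc : Proc Name → Conf Name
  | par : Conf Name → Conf Name → Conf Name
  | hide : Set (Act Name) → Conf Name → Conf Name

/-- Pure configurations: parallel compositions of processes (no hiding),
i.e. the configurations of the paper. -/
inductive Conf.Pure {Name : Type} : Conf Name → Prop where
  | proc (p : Proc Name) : Pure (Conf.proc p)
  | par {c d} : Pure c → Pure d → Pure (Conf.par c d)

/-- The LTS on configurations: interleaving of non-✓ labels, synchronization of
complementary actions into τ, simultaneous ✓, and the projection rules. -/
inductive CStep {Name : Type} : Conf Name → Label Name → Conf Name → Prop where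
  | proc {p l p'} : Step p l p' → CStep (Conf.proc p) l (Conf.proc p')
  | parL {c l c'} (d) : CStep c l c' → l ≠ Label.tick →
      CStep (Conf.par c d) l (Conf.par c' d)
  | parR {d l d'} (c) : CStep d l d' → l ≠ Label.tick →
      CStep (Conf.par c d) l (Conf.par c d')
  | sync {c a c' d d'} : CStep c (Label.act a) c' → CStep d (Label.act (Act.co a)) d' →
      CStep (Conf.par c d) Label.tau (Conf.par c' d')
  | tick {c c' d d'} : CStep c Label.tick c' → CStep d Label.tick d' →
      CStep (Conf.par c d) Label.tick (Conf.par c' d')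
  | hideV {V : Set (Act Name)} {c a c'} : CStep c (Label.act a) c' → a ∈ V →
      CStep (Conf.hide V c) (Label.act a) (Conf.hide V c')
  | hideH {V : Set (Act Name)} {c a c'} : CStep c (Label.act a) c' → a ∉ V →
      CStep (Conf.hide V c) Label.tau (Conf.hide V c')
  | hideT {V : Set (Act Name)} {c c'} : CStep c Label.tau c' →
      CStep (Conf.hide V c) Label.tau (Conf.hide V c')

variable {Name : Type}

/-- Weak internal transitions `c ⇒ c'`. -/
def WTau : Conf Name → Conf Name → Prop :=
  Relation.ReflTransGen (fun c c' => CStep c Label.tau c')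

/-- Weak visible transition `c ⇒^a c'`. -/
def WAct (c : Conf Name) (a : Act Name) (c' : Conf Name) : Prop :=
  ∃ c₁ c₂, WTau c c₁ ∧ CStep c₁ (Label.act a) c₂ ∧ WTau c₂ c'

/-- Weak string transition `c ⇒^s c'` for `s ∈ Act*`. -/
inductive WString : Conf Name → List (Act Name) → Conf Name → Prop where
  | nil {c c'} : WTau c c' → WString c [] c'
  | cons {c a c₁ s c'} : WAct c a c₁ → WString c₁ s c' → WString c (a :: s) c'

/-- Traces of a configuration (restricted to strings over `Act`). -/
def Tr (c : Conf Name) : Set (List (Act Name)) := {s | ∃ c', WString c s c'}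

/-- Divergence: an infinite sequence of τ-transitions. -/
def Div (c : Conf Name) : Prop :=
  ∃ f : ℕ → Conf Name, f 0 = c ∧ ∀ n, CStep (f n) Label.tau (f (n + 1))

/-- Convergence. -/
def Conv (c : Conf Name) : Prop := ¬ Div c

/-- Convergence along a string: `c ⇓ s`. -/
def ConvS : Conf Name → List (Act Name) → Prop
  | c, [] => Conv c
  | c, a :: s => Conv c ∧ ∀ c', WAct c a c' → ConvS c' s

/-- `c MUST L`. -/
def MUSTone (c : Conf Name) (L : Set (Act Name)) : Prop :=
  ∀ c', WTau c c' → ∃ a ∈ L, ∃ c'', WAct c' a c''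

/-- `P MUST L` for a set of configurations. -/
def MUSTset (P : Set (Conf Name)) (L : Set (Act Name)) : Prop :=
  ∀ c ∈ P, MUSTone c L

/-- Residuals: `(c after s)`. -/
def after (c : Conf Name) (s : List (Act Name)) : Set (Conf Name) :=
  {c' | WString c s c'}

/-- `c must o`: every maximal τ-computation of `c ‖ o` (tracked componentwise)
contains a state whose observer component has a ✓-transition. -/
def MustPass (c o : Conf Name) : Prop :=
  ∀ cs os : ℕ → Conf Name, cs 0 = c → os 0 = o →
    ((∀ k, CStep (Conf.par (cs k) (os k)) Label.tau (Conf.par (cs (k + 1)) (os (k + 1)))) →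
       ∃ j, ∃ o', CStep (os j) Label.tick o') ∧
    (∀ n : ℕ,
       (∀ k < n, CStep (Conf.par (cs k) (os k)) Label.tau (Conf.par (cs (k + 1)) (os (k + 1)))) →
       (¬ ∃ d, CStep (Conf.par (cs n) (os n)) Label.tau d) →
       ∃ j ≤ n, ∃ o', CStep (os j) Label.tick o')

/-- The classical must preorder `p ⊑_must q` (observers are all configurations
of the paper, i.e. pure configurations). -/
def MustLeq (p q : Proc Name) : Prop :=
  ∀ o : Conf Name, o.Pure → MustPass (Conf.proc p) o → MustPass (Conf.proc q) o

/-- An interface: a partition `{I_i}_{i ∈ 0..n}` of `Act` closed under complementation. -/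
structure Interface (Name : Type) (n : ℕ) where
  part : Fin (n + 1) → Set (Act Name)
  cover : ∀ a, ∃ i, a ∈ part i
  disjoint : ∀ i j, i ≠ j → ∀ a, a ∈ part i → a ∉ part j
  nonempty : ∀ i, (part i).Nonempty
  coClosed : ∀ i a, a ∈ part i → Act.co a ∈ part i

/-- `o₀ ‖ o₁ ‖ … ‖ o_n` as a configuration. -/
def parOfList (p : Proc Name) : List (Proc Name) → Conf Name
  | [] => Conf.proc p
  | q :: qs => Conf.par (Conf.proc p) (parOfList q qs)

/-- The parallel composition of an indexed family of processes. -/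
def parComp {n : ℕ} (os : Fin (n + 1) → Proc Name) : Conf Name :=
  parOfList (os 0) (List.ofFn fun i : Fin n => os i.succ)

/-- The uncoordinated must preorder `p ⊑^𝕀_unc q`. -/
def UncLeq {n : ℕ} (𝕀 : Interface Name n) (p q : Proc Name) : Prop :=
  ∀ os : Fin (n + 1) → Proc Name, (∀ i, Proc.acts (os i) ⊆ 𝕀.part i) →
    MustPass (Conf.proc p) (parComp os) → MustPass (Conf.proc q) (parComp os)

/-- The individualistic must preorder `p ⊑^𝕀_ind q`. -/
def IndLeq {n : ℕ} (𝕀 : Interface Name n) (p q : Proc Name) : Prop :=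
  ∀ os : Fin (n + 1) → Proc Name, (∀ i, Proc.acts (os i) ⊆ 𝕀.part i) →
    ∀ i, MustPass (Conf.hide (𝕀.part i) (Conf.proc p)) (Conf.proc (os i)) →
         MustPass (Conf.hide (𝕀.part i) (Conf.proc q)) (Conf.proc (os i))

/-- One swap of adjacent independent actions (w.r.t. a dependency relation `D`). -/
inductive SwapStep (D : Set (Act Name × Act Name)) :
    List (Act Name) → List (Act Name) → Prop where
  | swap (u v : List (Act Name)) (a b : Act Name) :
      (a, b) ∉ D → SwapStep D (u ++ a :: b :: v) (u ++ b :: a :: v)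

/-- Mazurkiewicz trace equivalence `≡_D`: the least congruence on `Act*`
with `αβ ≡ βα` whenever `(α,β) ∉ D`. -/
def MEquiv (D : Set (Act Name × Act Name)) : List (Act Name) → List (Act Name) → Prop :=
  Relation.EqvGen (SwapStep D)

/-- The dependency relation induced by an interface: `D = ∪_{I∈𝕀} I×I`. -/
def DepOf {n : ℕ} (𝕀 : Interface Name n) : Set (Act Name × Act Name) :=
  {x | ∃ i, x.1 ∈ 𝕀.part i ∧ x.2 ∈ 𝕀.part i}

/-- `c ⇓ [s]_D`. -/
def ConvMC (c : Conf Name) (D : Set (Act Name × Act Name)) (s : List (Act Name)) : Prop :=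
  ∀ t, MEquiv D s t → ConvS c t

/-- `(c after [s]_D)`. -/
def afterMC (c : Conf Name) (D : Set (Act Name × Act Name)) (s : List (Act Name)) :
    Set (Conf Name) :=
  {c' | ∃ t, MEquiv D s t ∧ WString c t c'}

/-- The trace-based characterisation `p ≼^𝕀 q` of the uncoordinated preorder. -/
def TraceLeqUnc {n : ℕ} (𝕀 : Interface Name n) (p q : Proc Name) : Prop :=
  ∀ (s : List (Act Name)) (i : Fin (n + 1)) (L : Set (Act Name)),
    L.Finite → L ⊆ 𝕀.part i → ConvMC (Conf.proc p) (DepOf 𝕀) s →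
      ConvMC (Conf.proc q) (DepOf 𝕀) s ∧
      (MUSTset (afterMC (Conf.proc p) (DepOf 𝕀) s) L →
       MUSTset (afterMC (Conf.proc q) (DepOf 𝕀) s) L)

open Classical in
/-- `s↾I`: the subsequence of `s` consisting of its symbols in `I`. -/
noncomputable def fproj (I : Set (Act Name)) (s : List (Act Name)) : List (Act Name) :=
  s.filter fun a => decide (a ∈ I)

/-- `c ⇓ ⟨s⟩_I`. -/
def ConvFC (c : Conf Name) (I : Set (Act Name)) (s : List (Act Name)) : Prop :=
  ∀ t, fproj I t = fproj I s → ConvS c t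

/-- `(c after ⟨s⟩_I)`. -/
def afterFC (c : Conf Name) (I : Set (Act Name)) (s : List (Act Name)) :
    Set (Conf Name) :=
  {c' | ∃ t, fproj I t = fproj I s ∧ WString c t c'}

/-- The filtered-trace characterisation `p ≼^𝕀_flt q` of the individualistic preorder. -/
def TraceLeqInd {n : ℕ} (𝕀 : Interface Name n) (p q : Proc Name) : Prop :=
  ∀ (i : Fin (n + 1)) (s : List (Act Name)), (∀ a ∈ s, a ∈ 𝕀.part i) →
    ∀ L : Set (Act Name), L.Finite → L ⊆ 𝕀.part i →
      ConvFC (Conf.proc p) (𝕀.part i) s →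
        ConvFC (Conf.proc q) (𝕀.part i) s ∧
        (MUSTset (afterFC (Conf.proc p) (𝕀.part i) s) (L ∪ (𝕀.part i)ᶜ) →
         MUSTset (afterFC (Conf.proc q) (𝕀.part i) s) (L ∪ (𝕀.part i)ᶜ))

/-- A configuration is unsuccessful if it has no ✓-transition. -/
def Unsucc (c : Conf Name) : Prop := ¬ ∃ c', CStep c Label.tick c'

/-- Unsuccessful weak internal transitions: all states passed through are unsuccessful. -/
inductive UTau : Conf Name → Conf Name → Prop where
  | refl {c} : Unsucc c → UTau c c
  | step {c c₁ c'} : Unsucc c → CStep c Label.tau c₁ → UTau c₁ c' → UTau c c'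

/-- Unsuccessful weak visible transition. -/
def UWAct (c : Conf Name) (a : Act Name) (c' : Conf Name) : Prop :=
  ∃ c₁ c₂, UTau c c₁ ∧ CStep c₁ (Label.act a) c₂ ∧ UTau c₂ c'

/-- Unsuccessful weak string transition (an unsuccessful weak computation `c ⇒^s c'`). -/
inductive UWString : Conf Name → List (Act Name) → Conf Name → Prop where
  | nil {c c'} : UTau c c' → UWString c [] c'
  | cons {c a c₁ s c'} : UWAct c a c₁ → UWString c₁ s c' → UWString c (a :: s) c'


namespace Proc

theorem subst_lift_cancel (u : Proc Name) (d : ℕ) (x : Proc Name) :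
    subst d u (lift d x) = x := by
  induction x generalizing d u with
  | var k => simp only [lift]; split_ifs <;> simp only [subst] <;> grind
  | _ => simp_all [lift, subst]

theorem lift_lift {i d : ℕ} (h : i ≤ d) (x : Proc Name) :
    lift i (lift d x) = lift (d + 1) (lift i x) := by
  induction x generalizing d i with
  | var k => simp only [lift]; split_ifs <;> simp only [lift] <;> grind
  | _ => simp_all [lift]

theorem lift_subst {i d : ℕ} (h : i ≤ d) (u x : Proc Name) :
    lift d (subst i u x) = subst i (lift d u) (lift (d + 1) x) := by
  induction x generalizing d i u with
  | var k =>
    simp only [lift, subst]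
    split_ifs <;> simp only [lift, subst] <;> split_ifs <;> grind
  | fix p ih => simp [lift, subst, ih (Nat.succ_le_succ h), lift_lift]
  | _ => simp_all [lift, subst]

theorem subst_lift {i d : ℕ} (h : i ≤ d) (u x : Proc Name) :
    subst (d + 1) (lift i u) (lift i x) = lift i (subst d u x) := by
  induction x generalizing d i u with
  | var k =>
    simp only [lift, subst]
    split_ifs <;> simp only [lift, subst] <;> split_ifs <;> grind
  | fix p ih => simp [lift, subst, ← ih (Nat.succ_le_succ h), lift_lift]
  | _ => simp_all [lift, subst]

theorem subst_subst {i d : ℕ} (h : i ≤ d) (u v x : Proc Name) :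
    subst d u (subst i v x) = subst i (subst d u v) (subst (d + 1) (lift i u) x) := by
  induction x generalizing d i u v with
  | var k =>
    simp only [subst]
    split_ifs <;> (try simp only [subst]) <;> (try split_ifs) <;> grind [subst_lift_cancel, subst]
  | fix p ih =>
    simp [subst, ih (Nat.succ_le_succ h), lift_lift, subst_lift]
  | _ => simp_all [subst]

/-- The transitions of a process, computed without unfolding unguarded recursion. -/
def next : Proc Name → List (Label Name × Proc Name)
  | nil => []
  | one => [(.tick, nil)]
  | pre a p => [(.act a, p)]
  | tpre p => [(.tau, p)]
  | choice p q => next p ++ next q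
  | var _ => []
  | fix p => (next p).map (Prod.map id (subst 0 (fix p)))

theorem next_lift (d : ℕ) (p : Proc Name) :
    next (lift d p) = (next p).map (Prod.map id (lift d)) := by
  induction p generalizing d with
  | var k => simp only [lift]; split_ifs <;> rfl
  | fix p ih =>
    simp only [lift, next, ih, List.map_map]
    refine List.map_congr_left fun x _ => ?_
    simp [Prod.map, lift_subst, lift]
  | _ => simp_all [lift, next]

theorem mem_next_subst {d : ℕ} {u p : Proc Name} {x : Label Name × Proc Name}
    (hx : x ∈ next (subst d u p)) :
    x ∈ (next p).map (Prod.map id (subst d u)) ∨ x ∈ next u := by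
  induction p generalizing d u x with
  | var k =>
    simp only [subst] at hx
    split_ifs at hx
    · exact .inr hx
    · simp [next] at hx
    · simp [next] at hx
  | choice p q ihp ihq =>
    simp only [subst, next, List.map_append, List.mem_append] at hx ⊢
    rcases hx with hx | hx
    · rcases ihp hx with h | h <;> simp [h]
    · rcases ihq hx with h | h <;> simp [h]
  | fix p ih =>
    simp only [subst, next, List.mem_map] at hx
    obtain ⟨y, hy, rfl⟩ := hx
    rcases ih hy with h | h
    · obtain ⟨z, hz, rfl⟩ := List.mem_map.1 h
      refine .inl (List.mem_map.2 ⟨_, List.mem_map.2 ⟨z, hz, rfl⟩, ?_⟩)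
      simp [Prod.map, subst_subst, subst]
    · rw [next_lift] at h
      obtain ⟨z, hz, rfl⟩ := List.mem_map.1 h
      right
      simpa [Prod.map, subst_lift_cancel] using hz
  | _ => simp_all [subst, next]

end Proc

theorem Step.mem_next {p p' : Proc Name} {l : Label Name} (h : Step p l p') :
    (l, p') ∈ p.next := by
  induction h with
  | fix _ ih => rcases Proc.mem_next_subst ih with h | h <;> exact h
  | _ => simp_all [Proc.next]

theorem finite_cstep_proc (p : Proc Name) :
    {x : Label Name × Conf Name | CStep (.proc p) x.1 x.2}.Finite := by
  refine ((List.finite_toSet p.next).image (Prod.map id Conf.proc)).subset ?_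
  rintro ⟨l, c⟩ h
  cases h with
  | proc h => exact ⟨_, h.mem_next, rfl⟩

theorem Conf.Pure.cstep {c c' : Conf Name} {l : Label Name} (hc : c.Pure) (h : CStep c l c') :
    c'.Pure := by
  induction h with
  | proc => exact .proc _
  | parL _ _ _ ih => cases hc with | par h₁ h₂ => exact .par (ih h₁) h₂
  | parR _ _ _ ih => cases hc with | par h₁ h₂ => exact .par h₁ (ih h₂)
  | sync _ _ ih₁ ih₂ => cases hc with | par h₁ h₂ => exact .par (ih₁ h₁) (ih₂ h₂)
  | tick _ _ ih₁ ih₂ => cases hc with | par h₁ h₂ => exact .par (ih₁ h₁) (ih₂ h₂)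
  | _ => cases hc

theorem Conf.Pure.finite_initials {c : Conf Name} (hc : c.Pure) :
    {a | ∃ c', CStep c (.act a) c'}.Finite := by
  induction hc with
  | proc p =>
    refine ((finite_cstep_proc p).image Prod.fst).preimage
      (f := Label.act) (fun _ _ _ _ h => Label.act.inj h) |>.subset ?_
    rintro a ⟨c', h⟩
    exact ⟨(.act a, c'), h, rfl⟩
  | par _ _ ih₁ ih₂ =>
    refine (ih₁.union ih₂).subset ?_
    rintro a ⟨c', h⟩
    cases h with
    | parL _ h _ => exact .inl ⟨_, h⟩
    | parR _ h _ => exact .inr ⟨_, h⟩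

@[simp] theorem Act.co_co (a : Act Name) : a.co.co = a := by cases a <;> rfl

theorem conv_iff_acc {c : Conf Name} : Conv c ↔ Acc (fun d d' => CStep d' .tau d) c := by
  rw [Conv, Div, ← not_iff_not, not_not]
  exact (not_acc_iff_exists_descending_chain (r := fun d d' => CStep d' .tau d)).symm

theorem Conv.exists_stable {c : Conf Name} (h : Conv c) :
    ∃ c', WTau c c' ∧ ∀ d, ¬ CStep c' .tau d := by
  rw [conv_iff_acc] at h
  induction h with
  | intro c _ ih =>
    by_cases hc : ∃ d, CStep c .tau d
    · obtain ⟨d, hd⟩ := hc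
      obtain ⟨c', h, hs⟩ := ih d hd
      exact ⟨c', .head hd h, hs⟩
    · exact ⟨c, .refl, not_exists.1 hc⟩

theorem Conv.cstep {c c' : Conf Name} (hc : Conv c) (h : CStep c .tau c') : Conv c' := by
  rw [conv_iff_acc] at *
  exact hc.inv h

theorem WAct.head {c c₁ c' : Conf Name} {a : Act Name} (h : CStep c .tau c₁) (h' : WAct c₁ a c') :
    WAct c a c' := by
  obtain ⟨d, d', h₁, h₂, h₃⟩ := h'
  exact ⟨d, d', .head h h₁, h₂, h₃⟩

theorem WAct.of_cstep {c c' : Conf Name} {a : Act Name} (h : CStep c (.act a) c') : WAct c a c' :=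
  ⟨c, c', .refl, h, .refl⟩

theorem WString.head {c c₁ c' : Conf Name} {s : List (Act Name)} (h : CStep c .tau c₁)
    (h' : WString c₁ s c') : WString c s c' := by
  cases h' with
  | nil h' => exact .nil (.head h h')
  | cons h₁ h₂ => exact .cons (h₁.head h) h₂

theorem ConvS.cstep {c c' : Conf Name} {s : List (Act Name)} (hc : ConvS c s)
    (h : CStep c .tau c') : ConvS c' s := by
  cases s with
  | nil => exact Conv.cstep hc h
  | cons a s => exact ⟨hc.1.cstep h, fun d hd => hc.2 d (hd.head h)⟩

/-- Weak string transitions presented as sequences of single steps. -/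
inductive Run : Conf Name → List (Act Name) → Conf Name → Prop where
  | refl (c) : Run c [] c
  | tau {c c₁ s c'} : CStep c .tau c₁ → Run c₁ s c' → Run c s c'
  | act {c a c₁ s c'} : CStep c (.act a) c₁ → Run c₁ s c' → Run c (a :: s) c'

theorem Run.of_wtau {c d c' : Conf Name} {s : List (Act Name)} (h : WTau c d) (h' : Run d s c') :
    Run c s c' := by
  induction h using Relation.ReflTransGen.head_induction_on with
  | refl => exact h'
  | head h _ ih => exact .tau h ih

theorem run_iff_wstring {c c' : Conf Name} {s : List (Act Name)} :
    Run c s c' ↔ WString c s c' := by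
  constructor
  · intro h
    induction h with
    | refl c => exact .nil .refl
    | tau h _ ih => exact ih.head h
    | act h _ ih => exact .cons (.of_cstep h) ih
  · intro h
    induction h with
    | nil h => exact .of_wtau h (.refl _)
    | cons h _ ih =>
      obtain ⟨d, d', h₁, h₂, h₃⟩ := h
      exact .of_wtau h₁ (.act h₂ (.of_wtau h₃ ih))

theorem Run.trans {c d e : Conf Name} {s t : List (Act Name)} (h : Run c s d) (h' : Run d t e) :
    Run c (s ++ t) e := by
  induction h with
  | refl => exact h'
  | tau h _ ih => exact .tau h (ih h')
  | act h _ ih => exact .act h (ih h')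

theorem Run.exists_prefix {c e : Conf Name} {s t : List (Act Name)} (h : Run c (s ++ t) e) :
    ∃ d, Run c s d := by
  generalize hu : s ++ t = u at h
  induction h generalizing s with
  | refl c =>
    obtain ⟨rfl, rfl⟩ := List.append_eq_nil_iff.1 hu
    exact ⟨c, .refl c⟩
  | tau h _ ih =>
    obtain ⟨d, hd⟩ := ih hu
    exact ⟨d, .tau h hd⟩
  | @act c a c₁ u c' h _ ih =>
    cases s with
    | nil => exact ⟨c, .refl c⟩
    | cons b s =>
      obtain ⟨rfl, rfl⟩ := List.cons.inj hu
      obtain ⟨d, hd⟩ := ih rfl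
      exact ⟨d, .act h hd⟩

theorem ConvS.conv_of_run {c c' : Conf Name} {s : List (Act Name)} (hc : ConvS c s)
    (h : Run c s c') : Conv c' := by
  induction h with
  | refl => exact hc
  | tau h _ ih => exact ih (hc.cstep h)
  | act h _ ih => exact ih (hc.2 _ (.of_cstep h))

theorem exists_eq_proc_of_cstep {p : Proc Name} {c' : Conf Name} {l : Label Name}
    (h : CStep (.proc p) l c') : ∃ p', c' = .proc p' := by
  cases h; exact ⟨_, rfl⟩

/-- A τ-step of `c ‖ o`, classified by the action of `c` it synchronizes on, if any. -/
inductive PairStep : Conf Name → Conf Name → Option (Act Name) → Conf Name → Conf Name → Prop where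
  | left {c c'} (o) : CStep c .tau c' → PairStep c o none c' o
  | right (c) {o o'} : CStep o .tau o' → PairStep c o none c o'
  | sync {c a c' o o'} : CStep c (.act a) c' → CStep o (.act a.co) o' →
      PairStep c o (some a) c' o'

theorem cstep_par_tau_iff {c o d : Conf Name} :
    CStep (.par c o) .tau d ↔ ∃ l c' o', d = .par c' o' ∧ PairStep c o l c' o' := by
  constructor
  · intro h
    cases h with
    | parL _ h _ => exact ⟨_, _, _, rfl, .left _ h⟩
    | parR _ h _ => exact ⟨_, _, _, rfl, .right _ h⟩
    | sync h h' => exact ⟨_, _, _, rfl, .sync h h'⟩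
  · rintro ⟨l, c', o', rfl, h⟩
    cases h with
    | left _ h => exact .parL _ h (by simp)
    | right h => exact .parR _ h (by simp)
    | sync h h' => exact .sync h h'

theorem cstep_par_par_iff {c o c' o' : Conf Name} :
    CStep (.par c o) .tau (.par c' o') ↔ ∃ l, PairStep c o l c' o' := by
  rw [cstep_par_tau_iff]
  constructor
  · rintro ⟨l, _, _, h, h'⟩
    cases h
    exact ⟨l, h'⟩
  · rintro ⟨l, h⟩
    exact ⟨l, _, _, rfl, h⟩

/-- `c ‖ o` has no τ-transition. -/
def Stuck (c o : Conf Name) : Prop := ∀ l c' o', ¬ PairStep c o l c' o'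

theorem stuck_iff {c o : Conf Name} : Stuck c o ↔ ¬ ∃ d, CStep (.par c o) .tau d := by
  simp only [Stuck, cstep_par_tau_iff]
  grind

theorem MustPass.of_tick {c o : Conf Name} (h : ¬ Unsucc o) : MustPass c o := by
  rw [Unsucc, not_not] at h
  rintro cs os rfl rfl
  exact ⟨fun _ => ⟨0, h⟩, fun n _ _ => ⟨0, Nat.zero_le n, h⟩⟩

theorem MustPass.of_succ {c o : Conf Name} (h : ¬ Stuck c o)
    (h' : ∀ l c' o', PairStep c o l c' o' → MustPass c' o') : MustPass c o := by
  rintro cs os rfl rfl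
  constructor
  · intro hs
    obtain ⟨l, hl⟩ := cstep_par_par_iff.1 (hs 0)
    obtain ⟨j, hj⟩ := (h' _ _ _ hl (fun k => cs (k + 1)) (fun k => os (k + 1)) rfl rfl).1
      fun k => hs (k + 1)
    exact ⟨j + 1, hj⟩
  · rintro (_ | n) hs hn
    · exact absurd (stuck_iff.2 hn) h
    · obtain ⟨l, hl⟩ := cstep_par_par_iff.1 (hs 0 n.succ_pos)
      obtain ⟨j, hjn, hj⟩ := (h' _ _ _ hl (fun k => cs (k + 1)) (fun k => os (k + 1)) rfl rfl).2
        n (fun k hk => hs (k + 1) (Nat.succ_lt_succ hk)) hn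
      exact ⟨j + 1, Nat.succ_le_succ hjn, hj⟩

/-- Coinduction principle for failing a must test. -/
theorem not_mustPass_of_invariant (R : Conf Name → Conf Name → Prop)
    (hR : ∀ c o, R c o → Unsucc o ∧ (Stuck c o ∨ ∃ l c' o', PairStep c o l c' o' ∧ R c' o'))
    {c o : Conf Name} (h : R c o) : ¬ MustPass c o := by
  classical
  intro hm
  let S := {x : Conf Name × Conf Name // R x.1 x.2}
  have hstep : ∀ x : S, ∃ y : S, ¬ Stuck x.1.1 x.1.2 → ∃ l, PairStep x.1.1 x.1.2 l y.1.1 y.1.2 := by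
    intro x
    rcases (hR _ _ x.2).2 with hs | ⟨l, c', o', hs, hr⟩
    · exact ⟨x, fun h => absurd hs h⟩
    · exact ⟨⟨(c', o'), hr⟩, fun _ => ⟨l, hs⟩⟩
  choose f hf using hstep
  let g : ℕ → S := fun n => f^[n] ⟨(c, o), h⟩
  have hg : ∀ n, ¬ Stuck (g n).1.1 (g n).1.2 → CStep (.par (g n).1.1 (g n).1.2) .tau
      (.par (g (n + 1)).1.1 (g (n + 1)).1.2) := by
    intro n hn
    have : g (n + 1) = f (g n) := Function.iterate_succ_apply' f n _
    rw [this]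
    exact cstep_par_par_iff.2 (hf _ hn)
  have hm' := hm (fun n => (g n).1.1) (fun n => (g n).1.2) rfl rfl
  have hun : ∀ n, Unsucc (g n).1.2 := fun n => (hR _ _ (g n).2).1
  by_cases hs : ∃ n, Stuck (g n).1.1 (g n).1.2
  · obtain ⟨j, _, hj⟩ := hm'.2 (Nat.find hs) (fun k hk => hg k (Nat.find_min hs hk))
      (stuck_iff.1 (Nat.find_spec hs))
    exact hun j hj
  · obtain ⟨j, hj⟩ := hm'.1 fun k => hg k (not_exists.1 hs k)
    exact hun j hj

theorem MustPass.unsucc_of_not {c o : Conf Name} (h : ¬ MustPass c o) : Unsucc o := by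
  by_contra h'
  exact h (.of_tick h')

theorem MustPass.stuck_or_step_of_not {c o : Conf Name} (h : ¬ MustPass c o) :
    Stuck c o ∨ ∃ l c' o', PairStep c o l c' o' ∧ ¬ MustPass c' o' := by
  by_contra! h'
  exact h (.of_succ h'.1 h'.2)

theorem not_mustPass_of_pairStep {c o c' o' : Conf Name} {l : Option (Act Name)} (hu : Unsucc o)
    (hs : PairStep c o l c' o') (h : ¬ MustPass c' o') : ¬ MustPass c o := by
  refine not_mustPass_of_invariant (fun d e => (d = c ∧ e = o) ∨ ¬ MustPass d e) ?_
    (.inl ⟨rfl, rfl⟩)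
  rintro d e (⟨rfl, rfl⟩ | hde)
  · exact ⟨hu, .inr ⟨l, c', o', hs, .inr h⟩⟩
  · refine ⟨MustPass.unsucc_of_not hde, (MustPass.stuck_or_step_of_not hde).imp_right ?_⟩
    rintro ⟨l, c', o', h₁, h₂⟩
    exact ⟨l, c', o', h₁, .inr h₂⟩

theorem not_mustPass_of_stuck {c o : Conf Name} (hu : Unsucc o) (hs : Stuck c o) :
    ¬ MustPass c o := by
  refine not_mustPass_of_invariant (fun d e => d = c ∧ e = o) ?_ ⟨rfl, rfl⟩
  rintro d e ⟨rfl, rfl⟩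
  exact ⟨hu, .inl hs⟩

theorem not_mustPass_of_div {c o : Conf Name} (hu : Unsucc o) (hc : Div c) : ¬ MustPass c o := by
  obtain ⟨f, rfl, hf⟩ := hc
  refine not_mustPass_of_invariant (fun d e => (∃ n, d = f n) ∧ e = o) ?_ ⟨⟨0, rfl⟩, rfl⟩
  rintro _ e ⟨⟨n, rfl⟩, rfl⟩
  exact ⟨hu, .inr ⟨_, _, _, .left _ (hf n), ⟨n + 1, rfl⟩, rfl⟩⟩

theorem not_mustPass_of_wtau {c c' o : Conf Name} (hu : Unsucc o) (hc : WTau c c')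
    (h : ¬ MustPass c' o) : ¬ MustPass c o := by
  induction hc using Relation.ReflTransGen.head_induction_on with
  | refl => exact h
  | head hs _ ih => exact not_mustPass_of_pairStep hu (.left _ hs) ih

/-- Unsuccessful runs of an observer, recording the actions of its partner. -/
inductive ObsRun : Conf Name → List (Act Name) → Conf Name → Prop where
  | refl {o} : Unsucc o → ObsRun o [] o
  | tau {o o₁ s o'} : Unsucc o → CStep o .tau o₁ → ObsRun o₁ s o' → ObsRun o s o'
  | act {o a o₁ s o'} : Unsucc o → CStep o (.act (Act.co a)) o₁ → ObsRun o₁ s o' →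
      ObsRun o (a :: s) o'

theorem ObsRun.unsucc {o o' : Conf Name} {s : List (Act Name)} (h : ObsRun o s o') :
    Unsucc o := by
  cases h <;> assumption

theorem not_mustPass_of_run {c c' o o' : Conf Name} {s : List (Act Name)} (hc : Run c s c')
    (ho : ObsRun o s o') (h : ¬ MustPass c' o') : ¬ MustPass c o := by
  induction hc generalizing o with
  | refl c =>
    generalize hs : ([] : List (Act Name)) = s at ho
    induction ho with
    | refl => exact h
    | tau hu hs' _ ih => exact not_mustPass_of_pairStep hu (.right _ hs') (ih h hs)
    | act => cases hs
  | tau hs _ ih => exact not_mustPass_of_pairStep ho.unsucc (.left _ hs) (ih ho h)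
  | @act c a c₁ s c' hs _ ih =>
    generalize ht : a :: s = t at ho
    induction ho with
    | refl => cases ht
    | tau hu hs' _ ih' => exact not_mustPass_of_pairStep hu (.right _ hs') (ih' ih h ht)
    | act hu hs' ho' =>
      obtain ⟨rfl, rfl⟩ := List.cons.inj ht
      exact not_mustPass_of_pairStep hu (.sync hs hs') (ih ho' h)

theorem not_mustPass_of_not_convS {c o o' : Conf Name} {s : List (Act Name)}
    (ho : ObsRun o s o') (h : ¬ ConvS c s) : ¬ MustPass c o := by
  induction ho generalizing c with
  | refl hu => exact not_mustPass_of_div hu (not_not.1 h)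
  | tau hu hs _ ih => exact not_mustPass_of_pairStep hu (.right _ hs) (ih h)
  | @act o a o₁ s o' hu hs ho ih =>
    by_cases hc : Conv c
    · have : ∃ c', WAct c a c' ∧ ¬ ConvS c' s := by
        by_contra! h'
        exact h ⟨hc, h'⟩
      obtain ⟨c', ⟨d, d', h₁, h₂, h₃⟩, h'⟩ := this
      exact not_mustPass_of_wtau hu h₁ (not_mustPass_of_pairStep hu (.sync h₂ hs)
        (not_mustPass_of_wtau ho.unsucc h₃ (ih h')))
    · exact not_mustPass_of_div hu (not_not.1 hc)

theorem ObsRun.unsucc_right {o o' : Conf Name} {s : List (Act Name)} (h : ObsRun o s o') :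
    Unsucc o' := by
  induction h <;> assumption

theorem ObsRun.pure {o o' : Conf Name} {s : List (Act Name)} (h : ObsRun o s o') (ho : o.Pure) :
    o'.Pure := by
  induction h with
  | refl => exact ho
  | tau _ hs _ ih => exact ih (ho.cstep hs)
  | act _ hs _ ih => exact ih (ho.cstep hs)

/-- The trace-based preorder on processes that characterises the must preorder. -/
def TraceLeq (p q : Proc Name) : Prop :=
  ∀ (s : List (Act Name)) (L : Set (Act Name)), L.Finite →
    ConvS (.proc p) s →
      ConvS (.proc q) s ∧ (MUSTset (after (.proc p) s) L → MUSTset (after (.proc q) s) L)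

theorem TraceLeq.exists_run {p q : Proc Name} (h : TraceLeq p q) {s : List (Act Name)}
    {q' : Conf Name} (hp : ConvS (.proc p) s) (hq : Run (.proc q) s q') :
    ∃ p', Run (.proc p) s p' := by
  by_contra! h'
  obtain ⟨a, ha, _⟩ := (h s ∅ Set.finite_empty hp).2
    (fun c hc => absurd (run_iff_wstring.2 hc) (h' c)) q' (run_iff_wstring.1 hq) q' .refl
  exact ha

theorem TraceLeq.not_mustPass_of_stuck {p q : Proc Name} (h : TraceLeq p q) {s : List (Act Name)}
    {q' o o' : Conf Name} (hq : Run (.proc q) s q') (ho : ObsRun o s o') (hpure : o.Pure)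
    (hs : Stuck q' o') : ¬ MustPass (.proc p) o := by
  by_cases hp : ConvS (.proc p) s
  swap
  · exact not_mustPass_of_not_convS ho hp
  let L : Set (Act Name) := {a | ∃ d, CStep o' (.act a.co) d}
  have hL : L.Finite :=
    (ho.pure hpure).finite_initials.preimage (f := Act.co)
      (Function.LeftInverse.injective Act.co_co).injOn
  have hnot : ¬ MUSTset (after (.proc q) s) L := by
    intro hm
    obtain ⟨a, ⟨d, hd⟩, _, e, e', h₁, h₂, -⟩ := hm q' (run_iff_wstring.1 hq) q' .refl
    rcases Relation.ReflTransGen.cases_head h₁ with rfl | ⟨_, h₁, -⟩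
    · exact hs _ _ _ (.sync h₂ hd)
    · exact hs _ _ _ (.left _ h₁)
  have hnot' := mt (h s L hL hp).2 hnot
  simp only [MUSTset, MUSTone, not_forall, not_exists, not_and] at hnot'
  obtain ⟨p₁, hp₁, p₂, hp₂, hL'⟩ := hnot'
  have hrun : Run (.proc p) s p₂ := by
    simpa using (run_iff_wstring.2 hp₁).trans (.of_wtau hp₂ (.refl p₂))
  obtain ⟨p₃, hp₃, hstable⟩ := (hp.conv_of_run hrun).exists_stable
  have hrun' : Run (.proc p) s p₃ := by
    simpa using hrun.trans (.of_wtau hp₃ (.refl p₃))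
  refine not_mustPass_of_run hrun' ho (MultipartyTesting.not_mustPass_of_stuck ho.unsucc_right ?_)
  intro l c' d hstep
  cases hstep with
  | left _ hc => exact hstable _ hc
  | right hd => exact hs _ _ _ (.right _ hd)
  | sync hc hd => exact hL' _ ⟨_, hd⟩ _ ⟨p₃, _, hp₃, hc, .refl⟩

/-- The visible actions among the `n` labels of `l` starting at index `k`. -/
def word (l : ℕ → Option (Act Name)) : ℕ → ℕ → List (Act Name)
  | _, 0 => []
  | k, n + 1 => (l k).toList ++ word l (k + 1) n

theorem word_prefix_succ (l : ℕ → Option (Act Name)) (k n : ℕ) :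
    word l k n <+: word l k (n + 1) := by
  induction n generalizing k with
  | zero => exact List.nil_prefix
  | succ n ih => exact (List.prefix_append_right_inj _).2 (ih (k + 1))

/-- `c` can perform every finite part of the word of `l` starting at index `k`. -/
def CanFollow (l : ℕ → Option (Act Name)) (k : ℕ) (c : Conf Name) : Prop :=
  ∀ n, ∃ c', Run c (word l k n) c'

theorem antitone_run_word (l : ℕ → Option (Act Name)) (k : ℕ) (c : Conf Name) :
    Antitone fun n => ∃ c', Run c (word l k n) c' := by
  refine antitone_nat_of_succ_le fun n => ?_
  rintro ⟨c', h⟩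
  obtain ⟨t, ht⟩ := word_prefix_succ l k n
  rw [← ht] at h
  exact h.exists_prefix

theorem CanFollow.succ {l : ℕ → Option (Act Name)} {k : ℕ} {c : Conf Name}
    (h : CanFollow l k c) (hk : l k = none) : CanFollow l (k + 1) c := by
  intro n
  simpa [word, hk] using h (n + 1)

theorem exists_forall_of_antitone {α : Type*} {S : Set α} (hS : S.Finite) {P : α → ℕ → Prop}
    (hP : ∀ x, Antitone (P x)) (h : ∀ n, ∃ x ∈ S, P x n) : ∃ x ∈ S, ∀ n, P x n := by
  by_contra! h'
  choose! f hf using h'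
  obtain ⟨N, hN⟩ := (hS.image f).bddAbove
  obtain ⟨x, hx, hxN⟩ := h N
  exact hf x hx (hP x (hN ⟨x, hx, rfl⟩) hxN)

theorem CanFollow.exists_step {l : ℕ → Option (Act Name)} {k : ℕ} {p : Proc Name} {a : Act Name}
    (h : CanFollow l k (.proc p)) (hk : l k = some a) :
    (∃ c, CStep (.proc p) .tau c ∧ CanFollow l k c) ∨
      ∃ c, CStep (.proc p) (.act a) c ∧ CanFollow l (k + 1) c := by
  have hw : ∀ n, word l k (n + 1) = a :: word l (k + 1) n := fun n => by simp [word, hk]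
  let P : Label Name × Conf Name → ℕ → Prop := fun x n =>
    (x.1 = .tau ∧ ∃ c', Run x.2 (word l k n) c') ∨
      (x.1 = .act a ∧ ∃ c', Run x.2 (word l (k + 1) n) c')
  have hP : ∀ x, Antitone (P x) := fun x m n hmn =>
    Or.imp (And.imp_right (antitone_run_word l k x.2 hmn))
      (And.imp_right (antitone_run_word l (k + 1) x.2 hmn))
  obtain ⟨⟨m, c⟩, hc, hx⟩ := exists_forall_of_antitone (finite_cstep_proc p) hP fun n => by
    obtain ⟨c', hc'⟩ := h (n + 1)
    rw [hw] at hc'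
    cases hc' with
    | @tau _ c₁ _ _ h₁ h₂ =>
      rw [← hw] at h₂
      exact ⟨(.tau, c₁), h₁, .inl ⟨rfl, antitone_run_word l k c₁ n.le_succ ⟨_, h₂⟩⟩⟩
    | @act _ _ c₁ _ _ h₁ h₂ => exact ⟨(.act a, c₁), h₁, .inr ⟨rfl, _, h₂⟩⟩
  rcases hx 0 with ⟨rfl, -⟩ | ⟨rfl, -⟩
  · exact .inl ⟨c, hc, fun n => by simpa [P] using hx n⟩
  · exact .inr ⟨c, hc, fun n => by simpa [P] using hx n⟩

theorem run_word {cs os : ℕ → Conf Name} {l : ℕ → Option (Act Name)} {k n : ℕ}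
    (hs : ∀ j < k + n, PairStep (cs j) (os j) (l j) (cs (j + 1)) (os (j + 1)))
    (hu : ∀ j ≤ k + n, Unsucc (os j)) :
    Run (cs k) (word l k n) (cs (k + n)) ∧ ObsRun (os k) (word l k n) (os (k + n)) := by
  induction n generalizing k with
  | zero => exact ⟨.refl _, .refl (hu k le_rfl)⟩
  | succ n ih =>
    have e : k + (n + 1) = k + 1 + n := by omega
    rw [e] at hs hu ⊢
    obtain ⟨h₁, h₂⟩ := ih hs hu
    have hk := hs k (by omega)
    have hk' := hu k (by omega)
    simp only [word]
    generalize hc : cs (k + 1) = c at *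
    generalize ho : os (k + 1) = o at *
    generalize l k = m at *
    generalize hck : cs k = ck at *
    generalize hok : os k = ok at *
    cases hk with
    | left _ h => exact ⟨.tau h h₁, h₂⟩
    | right h => exact ⟨h₁, .tau hk' h h₂⟩
    | sync h h' => exact ⟨.act h h₁, .act hk' h' h₂⟩

theorem TraceLeq.not_mustPass_of_infinite {p q : Proc Name} (h : TraceLeq p q)
    {cs os : ℕ → Conf Name} {l : ℕ → Option (Act Name)} (hq : cs 0 = .proc q)
    (hs : ∀ j, PairStep (cs j) (os j) (l j) (cs (j + 1)) (os (j + 1)))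
    (hu : ∀ j, Unsucc (os j)) : ¬ MustPass (.proc p) (os 0) := by
  have hrun : ∀ n, Run (.proc q) (word l 0 n) (cs n) ∧ ObsRun (os 0) (word l 0 n) (os n) := by
    intro n
    have := run_word (k := 0) (n := n) (fun j _ => hs j) (fun j _ => hu j)
    simpa [hq] using this
  by_cases hp : ∀ n, ConvS (.proc p) (word l 0 n)
  swap
  · obtain ⟨n, hn⟩ := not_forall.1 hp
    exact not_mustPass_of_not_convS (hrun n).2 hn
  have hconv : ∀ n, Conv (cs n) := fun n =>
    (h _ ∅ Set.finite_empty (hp n)).1.conv_of_run (hrun n).1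
  let Left : ℕ → Prop := fun j => CStep (cs j) .tau (cs (j + 1)) ∧ os (j + 1) = os j ∧ l j = none
  have hright : ∀ k, ∃ n, ¬ Left (k + n) := by
    intro k
    by_contra! hk
    exact hconv k ⟨fun n => cs (k + n), rfl, fun n => (hk n).1⟩
  have hskip : ∀ k p', CanFollow l k p' → ∃ j, ¬ Left j ∧ os j = os k ∧ CanFollow l j p' := by
    intro k p' hp'
    obtain ⟨n, hn⟩ := hright k
    induction n generalizing k with
    | zero => exact ⟨k, hn, rfl, hp'⟩
    | succ n ih =>
      by_cases hk : Left k
      · obtain ⟨j, h₁, h₂, h₃⟩ := ih (k + 1) (hp'.succ hk.2.2) (by rwa [add_right_comm, add_assoc])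
        exact ⟨j, h₁, h₂.trans hk.2.1, h₃⟩
      · exact ⟨k, hk, rfl, hp'⟩
  refine not_mustPass_of_invariant
    (fun c o => ∃ k p', c = .proc p' ∧ o = os k ∧ CanFollow l k c) ?_
    ⟨0, p, rfl, rfl, fun n => h.exists_run (hp n) (hrun n).1⟩
  rintro _ _ ⟨k, p', rfl, rfl, hf⟩
  refine ⟨hu k, .inr ?_⟩
  obtain ⟨j, hj, hjk, hf⟩ := hskip k _ hf
  rw [← hjk]
  have hsj : Left j ∨ (CStep (os j) .tau (os (j + 1)) ∧ l j = none) ∨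
      ∃ a, CStep (os j) (.act (Act.co a)) (os (j + 1)) ∧ l j = some a := by
    have := hs j
    simp only [Left]
    generalize cs (j + 1) = c at *
    generalize os (j + 1) = o at *
    generalize l j = m at *
    generalize cs j = cj at *
    generalize os j = oj at *
    cases this with
    | left _ h => exact .inl ⟨h, rfl, rfl⟩
    | right h => exact .inr (.inl ⟨h, rfl⟩)
    | sync _ h => exact .inr (.inr ⟨_, h, rfl⟩)
  rcases hsj.resolve_left hj with ⟨ho, hl⟩ | ⟨a, ho, hl⟩
  · exact ⟨_, _, _, .right _ ho, j + 1, p', rfl, rfl, hf.succ hl⟩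
  · rcases hf.exists_step hl with ⟨c, hc, hf⟩ | ⟨c, hc, hf⟩
    · obtain ⟨p'', rfl⟩ := exists_eq_proc_of_cstep hc
      exact ⟨_, _, _, .left _ hc, j, p'', rfl, rfl, hf⟩
    · obtain ⟨p'', rfl⟩ := exists_eq_proc_of_cstep hc
      exact ⟨_, _, _, .sync hc ho, j + 1, p'', rfl, rfl, hf⟩

theorem TraceLeq.mustLeq {p q : Proc Name} (h : TraceLeq p q) : MustLeq p q := by
  rintro o hpure hp cs os hq rfl
  constructor
  · intro hs
    by_contra! hu
    choose l hl using fun k => cstep_par_par_iff.1 (hs k)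
    exact h.not_mustPass_of_infinite hq hl (fun j ⟨o', hj⟩ => hu j o' hj) hp
  · intro n hs hn
    by_contra! hu
    have : ∀ k, ∃ l, k < n → PairStep (cs k) (os k) l (cs (k + 1)) (os (k + 1)) := by
      intro k
      by_cases hk : k < n
      · obtain ⟨l, hl⟩ := cstep_par_par_iff.1 (hs k hk)
        exact ⟨l, fun _ => hl⟩
      · exact ⟨none, fun h => absurd h hk⟩
    choose l hl using this
    have hrun := run_word (cs := cs) (os := os) (l := l) (k := 0) (n := n)
      (fun j hj => hl j (by simpa using hj)) (fun j hj ⟨o', ho⟩ => hu j (by simpa using hj) o' ho)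
    rw [zero_add, hq] at hrun
    exact h.not_mustPass_of_stuck hrun.1 hrun.2 hpure (stuck_iff.2 hn) hp

/-- The observer that follows the complement of a string before behaving like `b`, and may
succeed silently at any earlier point. -/
def tester (b : Proc Name) : List (Act Name) → Proc Name
  | [] => b
  | a :: s => .choice (.tpre .one) (.pre a.co (tester b s))

/-- The observer that succeeds after synchronizing with one of the given actions. -/
def anyOf : List (Act Name) → Proc Name
  | [] => .nil
  | a :: l => .choice (.pre a.co .one) (anyOf l)

theorem step_tester_cons {b : Proc Name} {a : Act Name} {s : List (Act Name)} {l : Label Name}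
    {o : Conf Name} (h : CStep (.proc (tester b (a :: s))) l o) :
    l = .tau ∧ o = .proc .one ∨ l = .act a.co ∧ o = .proc (tester b s) := by
  cases h with
  | proc h =>
    cases h with
    | choiceL _ h => cases h; exact .inl ⟨rfl, rfl⟩
    | choiceR _ h => cases h; exact .inr ⟨rfl, rfl⟩

theorem step_anyOf {L : List (Act Name)} {l : Label Name} {o : Conf Name} :
    CStep (.proc (anyOf L)) l o ↔ ∃ a ∈ L, l = .act a.co ∧ o = .proc .one := by
  induction L with
  | nil =>
    refine ⟨fun h => ?_, by simp⟩
    cases h with | proc h => cases h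
  | cons a L ih =>
    constructor
    · intro h
      cases h with
      | proc h =>
        cases h with
        | choiceL _ h => cases h; exact ⟨a, by simp, rfl, rfl⟩
        | choiceR _ h =>
          obtain ⟨b, hb, h⟩ := ih.1 (.proc h)
          exact ⟨b, by simp [hb], h⟩
    · rintro ⟨b, hb, h⟩
      rcases List.mem_cons.1 hb with rfl | hb
      · obtain ⟨rfl, rfl⟩ := h
        exact .proc (.choiceL _ (.pre _ _))
      · obtain ⟨-, rfl⟩ := id h
        cases ih.2 ⟨b, hb, h⟩ with | proc h => exact .proc (.choiceR _ h)

theorem mustPass_one (c : Conf Name) : MustPass c (.proc .one) :=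
  .of_tick fun h => h ⟨_, .proc .one⟩

theorem unsucc_tpre_one : Unsucc (.proc (.tpre .one) : Conf Name) := by
  rintro ⟨_, h⟩
  cases h with | proc h => cases h

theorem unsucc_anyOf (L : List (Act Name)) : Unsucc (.proc (anyOf L)) := by
  rintro ⟨_, h⟩
  obtain ⟨_, _, h, _⟩ := step_anyOf.1 h
  cases h

theorem obsRun_tester {b : Proc Name} (hb : Unsucc (.proc b)) (s : List (Act Name)) :
    ObsRun (.proc (tester b s)) s (.proc b) := by
  induction s with
  | nil => exact .refl hb
  | cons a s ih =>
    refine .act ?_ (.proc (.choiceR _ (.pre _ _))) ih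
    rintro ⟨_, h⟩
    rcases step_tester_cons h with ⟨h, -⟩ | ⟨h, -⟩ <;> cases h

theorem mustPass_tester_cons {b : Proc Name} {a : Act Name} {s : List (Act Name)} {c : Conf Name}
    (hc : Conv c) (h : ∀ c', WAct c a c' → MustPass c' (.proc (tester b s))) :
    MustPass c (.proc (tester b (a :: s))) := by
  rw [conv_iff_acc] at hc
  induction hc with
  | intro c _ ih =>
    refine .of_succ (fun hs => hs _ _ _ (.right _ (.proc (.choiceL _ (.tpre _))))) ?_
    intro l c' o' hs
    cases hs with
    | left _ hs => exact ih _ hs fun d hd => h d (hd.head hs)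
    | right hs =>
      rcases step_tester_cons hs with ⟨-, rfl⟩ | ⟨h, -⟩
      · exact mustPass_one c
      · cases h
    | sync hs hs' =>
      rcases step_tester_cons hs' with ⟨h, -⟩ | ⟨h', rfl⟩
      · cases h
      · obtain rfl := (Function.LeftInverse.injective Act.co_co) (Label.act.inj h')
        exact h _ (.of_cstep hs)

theorem mustPass_tpre_one {c : Conf Name} (hc : Conv c) : MustPass c (.proc (.tpre .one)) := by
  rw [conv_iff_acc] at hc
  induction hc with
  | intro c _ ih =>
    refine .of_succ (fun hs => hs _ _ _ (.right _ (.proc (.tpre _)))) ?_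
    intro l c' o' hs
    cases hs with
    | left _ hs => exact ih _ hs
    | right hs => cases hs with | proc hs => cases hs; exact mustPass_one c
    | sync _ hs => cases hs with | proc hs => cases hs

theorem mustPass_anyOf {c : Conf Name} {L : List (Act Name)} (hc : Conv c)
    (h : MUSTone c {a | a ∈ L}) : MustPass c (.proc (anyOf L)) := by
  rw [conv_iff_acc] at hc
  induction hc with
  | intro c _ ih =>
    refine .of_succ ?_ ?_
    · obtain ⟨a, ha, _, d, d', h₁, h₂, -⟩ := h c .refl
      intro hs
      rcases Relation.ReflTransGen.cases_head h₁ with rfl | ⟨_, h₁, -⟩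
      · exact hs _ _ _ (.sync h₂ (step_anyOf.2 ⟨a, ha, rfl, rfl⟩))
      · exact hs _ _ _ (.left _ h₁)
    · intro l c' o' hs
      cases hs with
      | left _ hs => exact ih _ hs fun d hd => h d (.head hs hd)
      | right hs =>
        obtain ⟨_, _, h, _⟩ := step_anyOf.1 hs
        cases h
      | sync _ hs =>
        obtain ⟨_, _, _, rfl⟩ := step_anyOf.1 hs
        exact mustPass_one _

theorem mustPass_tester {b : Proc Name} {c : Conf Name} {s : List (Act Name)} (hc : ConvS c s)
    (h : ∀ c' ∈ after c s, Conv c' → MustPass c' (.proc b)) : MustPass c (.proc (tester b s)) := by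
  induction s generalizing c with
  | nil => exact h c (.nil .refl) hc
  | cons a s ih =>
    exact mustPass_tester_cons hc.1 fun c' hc' =>
      ih (hc.2 c' hc') fun d hd => h d (.cons hc' hd)

theorem MustLeq.traceLeq {p q : Proc Name} (h : MustLeq p q) : TraceLeq p q := by
  intro s L hL hp
  constructor
  · by_contra hq
    exact not_mustPass_of_not_convS (obsRun_tester unsucc_tpre_one s) hq
      (h _ (.proc _) (mustPass_tester hp fun _ _ => mustPass_tpre_one))
  · intro hm q₁ hq₁ q₂ hq₂
    obtain ⟨l, rfl⟩ : ∃ l : List (Act Name), {a | a ∈ l} = L :=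
      ⟨hL.toFinset.toList, by ext; simp⟩
    by_contra! hno
    refine not_mustPass_of_run (run_iff_wstring.2 hq₁) (obsRun_tester (unsucc_anyOf l) s) ?_
      (h _ (.proc _) (mustPass_tester hp fun c hc hc' => mustPass_anyOf hc' (hm c hc)))
    refine not_mustPass_of_wtau (unsucc_anyOf l) hq₂ ?_
    by_cases hconv : Conv q₂
    · obtain ⟨q₃, hq₃, hstable⟩ := hconv.exists_stable
      refine not_mustPass_of_wtau (unsucc_anyOf l) hq₃ (not_mustPass_of_stuck (unsucc_anyOf l) ?_)
      intro m c' o' hs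
      cases hs with
      | left _ hs => exact hstable _ hs
      | right hs =>
        obtain ⟨_, _, h, _⟩ := step_anyOf.1 hs
        cases h
      | sync hs hs' =>
        obtain ⟨a, ha, h', _⟩ := step_anyOf.1 hs'
        obtain rfl := (Function.LeftInverse.injective Act.co_co) (Label.act.inj h')
        exact hno _ ha _ ⟨q₃, _, hq₃, hs, .refl⟩
    · exact not_mustPass_of_div (unsucc_anyOf l) (not_not.1 hconv)

/-- De Nicola–Hennessy characterisation of the classical must preorder:
`p ⊑_must q` iff for every `s ∈ Act*` and every finite `L ⊆ Act`, if `p ⇓ s` then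
`q ⇓ s` and `(p after s) MUST L` implies `(q after s) MUST L`. -/
theorem must_characterisation (Name : Type) [Countable Name] (p q : Proc Name) :
    MustLeq p q ↔
      ∀ (s : List (Act Name)) (L : Set (Act Name)), L.Finite →
        ConvS (Conf.proc p) s →
          ConvS (Conf.proc q) s ∧
          (MUSTset (after (Conf.proc p) s) L → MUSTset (after (Conf.proc q) s) L) := by
  exact ⟨MustLeq.traceLeq, TraceLeq.mustLeq⟩

end MultipartyTesting
end

section
/- Let o = o₀‖…‖o_n be an uncoordinated observer for the interface 𝕀 = {I_i}_{i∈0..n} (i.e., n(o_i) ⊆ I_i and the name sets n(o_i) are pairwise disjoint) and let D be the dependency relation induced by 𝕀. Then for all s ∈ Act* and all t ∈ [s]_D, we have o ⇒^s o' if and only if o ⇒^t o'. -/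
/-!
Common definitions: sequential CCS with success, configurations,
must testing, Mazurkiewicz traces, filtered traces, interfaces, and
the classical / uncoordinated / individualistic must preorders.
-/

namespace MultipartyTesting

variable {Name : Type}

theorem Proc.acts_lift (p : Proc Name) (d : ℕ) : (p.lift d).acts = p.acts := by
  induction p generalizing d with
  | var k => simp only [Proc.lift]; split <;> rfl
  | _ => simp_all [Proc.lift, Proc.acts]

theorem Proc.acts_subst_subset (p : Proc Name) (d : ℕ) (u : Proc Name) :
    (Proc.subst d u p).acts ⊆ p.acts ∪ u.acts := by
  induction p generalizing d u with
  | nil => simp [Proc.subst, Proc.acts]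
  | one => simp [Proc.subst, Proc.acts]
  | pre a p ih =>
    simp only [Proc.subst, Proc.acts, Set.insert_union]
    exact Set.insert_subset_insert (ih d u)
  | tpre p ih => exact ih d u
  | choice p q ihp ihq =>
    simp only [Proc.subst, Proc.acts]
    have hp := ihp d u
    have hq := ihq d u
    grind
  | var k =>
    simp only [Proc.subst]
    split
    · simp
    · split <;> simp [Proc.acts]
  | fix p ih =>
    have h := ih (d + 1) (u.lift 0)
    rwa [Proc.acts_lift] at h

theorem Step.acts_subset {p p' : Proc Name} {l : Label Name} (h : Step p l p') :
    p'.acts ⊆ p.acts := by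
  induction h with
  | one => simp [Proc.acts]
  | pre a p => exact Set.subset_insert _ _
  | tpre p => exact subset_rfl
  | choiceL q _ ih => exact ih.trans Set.subset_union_left
  | choiceR p _ ih => exact ih.trans Set.subset_union_right
  | @fix p _ _ _ ih => exact ih.trans ((p.acts_subst_subset 0 p.fix).trans (Set.union_self _).subset)

theorem Step.mem_acts {p p' : Proc Name} {a : Act Name}
    (h : Step p (Label.act a) p') : a ∈ p.acts := by
  generalize hl : Label.act a = l at h
  induction h with
  | one => cases hl
  | pre b p => cases hl; exact Set.mem_insert _ _
  | tpre p => cases hl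
  | choiceL q _ ih => exact Or.inl (ih hl)
  | choiceR p _ ih => exact Or.inr (ih hl)
  | @fix p _ _ _ ih => exact (Set.union_self p.acts).subset (p.acts_subst_subset 0 p.fix (ih hl))

/-- The set of actions occurring in the processes of a configuration. -/
def Conf.acts : Conf Name → Set (Act Name)
  | proc p => p.acts
  | par c d => c.acts ∪ d.acts
  | hide _ c => c.acts

theorem CStep.acts_subset {c c' : Conf Name} {l : Label Name}
    (h : CStep c l c') : c'.acts ⊆ c.acts := by
  induction h with
  | proc h => exact h.acts_subset
  | parL d _ _ ih => exact Set.union_subset_union_left _ ih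
  | parR c _ _ ih => exact Set.union_subset_union_right _ ih
  | sync _ _ ih₁ ih₂ => exact Set.union_subset_union ih₁ ih₂
  | tick _ _ ih₁ ih₂ => exact Set.union_subset_union ih₁ ih₂
  | hideV _ _ ih => exact ih
  | hideH _ _ ih => exact ih
  | hideT _ ih => exact ih

theorem CStep.mem_acts {c c' : Conf Name} {a : Act Name}
    (h : CStep c (Label.act a) c') : a ∈ c.acts := by
  generalize hl : Label.act a = l at h
  induction h with
  | proc h => cases hl; exact h.mem_acts
  | parL d _ _ ih => exact Or.inl (ih hl)
  | parR c _ _ ih => exact Or.inr (ih hl)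
  | sync => cases hl
  | tick => cases hl
  | hideV _ _ ih => exact ih hl
  | hideH => cases hl
  | hideT => cases hl

/-- `c` is a parallel composition of processes, each using pairwise `D`-dependent actions,
while the actions of distinct processes are `D`-independent. -/
inductive Conf.Uncoordinated (D : Set (Act Name × Act Name)) : Conf Name → Prop where
  | proc {p : Proc Name} (dep : ∀ a ∈ p.acts, ∀ b ∈ p.acts, (a, b) ∈ D) :
      Uncoordinated D (Conf.proc p)
  | par {c d : Conf Name} (left : Uncoordinated D c) (right : Uncoordinated D d)
      (indep : ∀ a ∈ c.acts, ∀ b ∈ d.acts, (a, b) ∉ D) : Uncoordinated D (Conf.par c d)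

section

variable {D : Set (Act Name × Act Name)}

theorem Conf.Uncoordinated.step {c c' : Conf Name} {l : Label Name}
    (hc : c.Uncoordinated D) (h : CStep c l c') : c'.Uncoordinated D := by
  induction h with
  | proc h =>
    obtain ⟨hp⟩ := hc
    exact .proc fun a ha b hb => hp a (h.acts_subset ha) b (h.acts_subset hb)
  | parL d h _ ih =>
    obtain _ | ⟨hl, hr, hi⟩ := hc
    exact .par (ih hl) hr fun a ha => hi a (h.acts_subset ha)
  | parR c h _ ih =>
    obtain _ | ⟨hl, hr, hi⟩ := hc
    exact .par hl (ih hr) fun a ha b hb => hi a ha b (h.acts_subset hb)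
  | sync h₁ h₂ ih₁ ih₂ =>
    obtain _ | ⟨hl, hr, hi⟩ := hc
    exact .par (ih₁ hl) (ih₂ hr) fun a ha b hb =>
      hi a (h₁.acts_subset ha) b (h₂.acts_subset hb)
  | tick h₁ h₂ ih₁ ih₂ =>
    obtain _ | ⟨hl, hr, hi⟩ := hc
    exact .par (ih₁ hl) (ih₂ hr) fun a ha b hb =>
      hi a (h₁.acts_subset ha) b (h₂.acts_subset hb)
  | hideV => cases hc
  | hideH => cases hc
  | hideT => cases hc

theorem Conf.Uncoordinated.wTau {c c' : Conf Name}
    (hc : c.Uncoordinated D) (h : WTau c c') : c'.Uncoordinated D := by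
  induction h with
  | refl => exact hc
  | tail _ h ih => exact ih.step h

theorem Conf.Uncoordinated.wAct {c c' : Conf Name} {a : Act Name}
    (hc : c.Uncoordinated D) (h : WAct c a c') : c'.Uncoordinated D := by
  obtain ⟨c₁, c₂, h₁, h₂, h₃⟩ := h
  exact ((hc.wTau h₁).step h₂).wTau h₃

theorem WTau.acts_subset {c c' : Conf Name} (h : WTau c c') : c'.acts ⊆ c.acts := by
  induction h with
  | refl => exact subset_rfl
  | tail _ h ih => exact h.acts_subset.trans ih

theorem WAct.mem_acts {c c' : Conf Name} {a : Act Name} (h : WAct c a c') : a ∈ c.acts := by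
  obtain ⟨c₁, c₂, h₁, h₂, -⟩ := h
  exact h₁.acts_subset h₂.mem_acts

theorem WAct.acts_subset {c c' : Conf Name} {a : Act Name} (h : WAct c a c') :
    c'.acts ⊆ c.acts := by
  obtain ⟨c₁, c₂, h₁, h₂, h₃⟩ := h
  exact h₃.acts_subset.trans (h₂.acts_subset.trans h₁.acts_subset)

theorem WTau.wAct {c c₁ c' : Conf Name} {a : Act Name} (h : WTau c c₁) (h' : WAct c₁ a c') :
    WAct c a c' := by
  obtain ⟨c₂, c₃, h₁, h₂, h₃⟩ := h'
  exact ⟨c₂, c₃, h.trans h₁, h₂, h₃⟩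

theorem WAct.wTau {c c₁ c' : Conf Name} {a : Act Name} (h : WAct c a c₁) (h' : WTau c₁ c') :
    WAct c a c' := by
  obtain ⟨c₂, c₃, h₁, h₂, h₃⟩ := h
  exact ⟨c₂, c₃, h₁, h₂, h₃.trans h'⟩

theorem WTau.par {c c' d d' : Conf Name} (hc : WTau c c') (hd : WTau d d') :
    WTau (Conf.par c d) (Conf.par c' d') := by
  induction hd with
  | refl =>
    induction hc with
    | refl => exact .refl
    | tail _ h ih => exact ih.tail (.parL d h nofun)
  | tail _ h ih => exact ih.tail (.parR c' h nofun)

theorem WAct.parL {c c' d d' : Conf Name} {a : Act Name} (hc : WAct c a c') (hd : WTau d d') :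
    WAct (Conf.par c d) a (Conf.par c' d') := by
  obtain ⟨c₁, c₂, h₁, h₂, h₃⟩ := hc
  exact ⟨_, _, h₁.par hd, .parL d' h₂ nofun, h₃.par .refl⟩

theorem WAct.parR {c c' d d' : Conf Name} {a : Act Name} (hc : WTau c c') (hd : WAct d a d') :
    WAct (Conf.par c d) a (Conf.par c' d') := by
  obtain ⟨d₁, d₂, h₁, h₂, h₃⟩ := hd
  exact ⟨_, _, hc.par h₁, .parR c' h₂ nofun, .par .refl h₃⟩

/-- Internal moves of independent configurations involve no synchronization. -/
theorem WTau.exists_of_par (hco : ∀ a, (a, Act.co a) ∈ D) {c d e : Conf Name}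
    (hi : ∀ a ∈ c.acts, ∀ b ∈ d.acts, (a, b) ∉ D) (h : WTau (Conf.par c d) e) :
    ∃ c' d', e = Conf.par c' d' ∧ WTau c c' ∧ WTau d d' := by
  induction h with
  | refl => exact ⟨c, d, rfl, .refl, .refl⟩
  | tail _ h ih =>
    obtain ⟨c', d', rfl, hc, hd⟩ := ih
    cases h with
    | parL _ h _ => exact ⟨_, _, rfl, hc.tail h, hd⟩
    | parR _ h _ => exact ⟨_, _, rfl, hc, hd.tail h⟩
    | sync h₁ h₂ =>
      exact absurd (hco _) (hi _ (hc.acts_subset h₁.mem_acts) _ (hd.acts_subset h₂.mem_acts))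

theorem WAct.exists_of_par (hco : ∀ a, (a, Act.co a) ∈ D) {c d e : Conf Name} {a : Act Name}
    (hi : ∀ a ∈ c.acts, ∀ b ∈ d.acts, (a, b) ∉ D) (h : WAct (Conf.par c d) a e) :
    ∃ c' d', e = Conf.par c' d' ∧ (WAct c a c' ∧ WTau d d' ∨ WTau c c' ∧ WAct d a d') := by
  obtain ⟨e₁, e₂, h₁, h₂, h₃⟩ := h
  obtain ⟨c₁, d₁, rfl, hc, hd⟩ := h₁.exists_of_par hco hi
  have hi₁ : ∀ a ∈ c₁.acts, ∀ b ∈ d₁.acts, (a, b) ∉ D := fun a ha b hb =>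
    hi a (hc.acts_subset ha) b (hd.acts_subset hb)
  cases h₂ with
  | parL _ h _ =>
    obtain ⟨c', d', rfl, hc', hd'⟩ :=
      h₃.exists_of_par hco fun a ha => hi₁ a (h.acts_subset ha)
    exact ⟨c', d', rfl, .inl ⟨⟨_, _, hc, h, hc'⟩, hd.trans hd'⟩⟩
  | parR _ h _ =>
    obtain ⟨c', d', rfl, hc', hd'⟩ :=
      h₃.exists_of_par hco fun a ha b hb => hi₁ a ha b (h.acts_subset hb)
    exact ⟨c', d', rfl, .inr ⟨hc.trans hc', ⟨_, _, hd, h, hd'⟩⟩⟩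

/-- Independent weak actions of an uncoordinated configuration commute. -/
theorem Conf.Uncoordinated.wAct_comm (hco : ∀ a, (a, Act.co a) ∈ D) {c c₁ c₂ : Conf Name}
    {a b : Act Name} (hc : c.Uncoordinated D) (hab : (a, b) ∉ D)
    (h₁ : WAct c a c₁) (h₂ : WAct c₁ b c₂) : ∃ c', WAct c b c' ∧ WAct c' a c₂ := by
  induction hc generalizing c₁ c₂ with
  | proc hp => exact absurd (hp a h₁.mem_acts b (h₁.acts_subset h₂.mem_acts)) hab
  | @par c d _ _ hi ihc ihd =>
    obtain ⟨c₁, d₁, rfl, hcd₁⟩ := h₁.exists_of_par hco hi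
    have hi₁ : ∀ a ∈ c₁.acts, ∀ b ∈ d₁.acts, (a, b) ∉ D := by
      obtain ⟨hc, hd⟩ | ⟨hc, hd⟩ := hcd₁ <;>
        exact fun a ha b hb => hi a (hc.acts_subset ha) b (hd.acts_subset hb)
    obtain ⟨c₂, d₂, rfl, hcd₂⟩ := h₂.exists_of_par hco hi₁
    obtain ⟨hc₁, hd₁⟩ | ⟨hc₁, hd₁⟩ := hcd₁ <;> obtain ⟨hc₂, hd₂⟩ | ⟨hc₂, hd₂⟩ := hcd₂
    · obtain ⟨c', h, h'⟩ := ihc hc₁ hc₂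
      exact ⟨.par c' d₂, h.parL (hd₁.trans hd₂), h'.parL .refl⟩
    · exact ⟨.par c d₂, .parR .refl (hd₁.wAct hd₂), (hc₁.wTau hc₂).parL .refl⟩
    · exact ⟨.par c₂ d, (hc₁.wAct hc₂).parL .refl, .parR .refl (hd₁.wTau hd₂)⟩
    · obtain ⟨d', h, h'⟩ := ihd hd₁ hd₂
      exact ⟨.par c₂ d', .parR (hc₁.trans hc₂) h, .parR .refl h'⟩

theorem Conf.Uncoordinated.wString_of_swapStep (hco : ∀ a, (a, Act.co a) ∈ D)
    {c c' : Conf Name} {s t : List (Act Name)} (hc : c.Uncoordinated D)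
    (hst : SwapStep D s t) (h : WString c s c') : WString c t c' := by
  obtain ⟨u, v, a, b, hab⟩ := hst
  induction u generalizing c with
  | nil =>
    obtain _ | ⟨h₁, _ | ⟨h₂, h₃⟩⟩ := h
    obtain ⟨d, hb, ha⟩ := hc.wAct_comm hco hab h₁ h₂
    exact .cons hb (.cons ha h₃)
  | cons x u ih =>
    obtain _ | ⟨h₁, h₂⟩ := h
    exact .cons h₁ (ih (hc.wAct h₁) h₂)

theorem SwapStep.symm (hsymm : ∀ a b, (a, b) ∈ D → (b, a) ∈ D) {s t : List (Act Name)}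
    (h : SwapStep D s t) : SwapStep D t s := by
  obtain ⟨u, v, a, b, hab⟩ := h
  exact .swap u v b a fun hba => hab (hsymm b a hba)

theorem Conf.Uncoordinated.wString_iff_of_mEquiv (hco : ∀ a, (a, Act.co a) ∈ D)
    (hsymm : ∀ a b, (a, b) ∈ D → (b, a) ∈ D) {c c' : Conf Name} {s t : List (Act Name)}
    (hc : c.Uncoordinated D) (hst : MEquiv D s t) : WString c s c' ↔ WString c t c' := by
  induction hst with
  | rel s t h =>
    exact ⟨hc.wString_of_swapStep hco h, hc.wString_of_swapStep hco (h.symm hsymm)⟩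
  | refl s => rfl
  | symm s t _ ih => exact ih.symm
  | trans s t u _ _ ih₁ ih₂ => exact ih₁.trans ih₂

theorem mem_acts_parOfList {a : Act Name} {p : Proc Name} {qs : List (Proc Name)}
    (h : a ∈ (parOfList p qs).acts) : ∃ q ∈ p :: qs, a ∈ q.acts := by
  induction qs generalizing p with
  | nil => exact ⟨p, by simp, h⟩
  | cons q qs ih =>
    obtain h | h := h
    · exact ⟨p, by simp, h⟩
    · obtain ⟨r, hr, har⟩ := ih h
      exact ⟨r, List.mem_cons_of_mem _ hr, har⟩

theorem uncoordinated_parOfList {p : Proc Name} {qs : List (Proc Name)}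
    (hdep : ∀ q ∈ p :: qs, ∀ a ∈ q.acts, ∀ b ∈ q.acts, (a, b) ∈ D)
    (hindep : (p :: qs).Pairwise fun q r => ∀ a ∈ q.acts, ∀ b ∈ r.acts, (a, b) ∉ D) :
    (parOfList p qs).Uncoordinated D := by
  induction qs generalizing p with
  | nil => exact .proc (hdep p (by simp))
  | cons q qs ih =>
    rw [List.pairwise_cons] at hindep
    refine .par (.proc (hdep p (by simp)))
      (ih (fun r hr => hdep r (List.mem_cons_of_mem _ hr)) hindep.2) fun a ha b hb => ?_
    obtain ⟨r, hr, hbr⟩ := mem_acts_parOfList hb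
    exact hindep.1 r hr a ha b hbr

theorem uncoordinated_parComp {n : ℕ} (𝕀 : Interface Name n) (os : Fin (n + 1) → Proc Name)
    (hos : ∀ i, Proc.acts (os i) ⊆ 𝕀.part i) : (parComp os).Uncoordinated (DepOf 𝕀) := by
  apply uncoordinated_parOfList <;> rw [← List.ofFn_succ]
  · intro q hq a ha b hb
    obtain ⟨i, rfl⟩ := List.mem_ofFn.1 hq
    exact ⟨i, hos i ha, hos i hb⟩
  · rw [List.pairwise_ofFn]
    rintro i j hij a ha b hb ⟨k, hak, hbk⟩
    obtain rfl : i = k := by_contra fun hik => 𝕀.disjoint i k hik a (hos i ha) hak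
    exact 𝕀.disjoint i j hij.ne b hbk (hos j hb)

end

/-- an uncoordinated observer reaches the same processes after executing
any string in a Mazurkiewicz equivalence class. -/
theorem uncoordinated_observer_trace_invariant (Name : Type) [Countable Name] {n : ℕ}
    (𝕀 : Interface Name n) (os : Fin (n + 1) → Proc Name)
    (hos : ∀ i, Proc.acts (os i) ⊆ 𝕀.part i)
    (s t : List (Act Name)) (hst : MEquiv (DepOf 𝕀) s t) (o' : Conf Name) :
    WString (parComp os) s o' ↔ WString (parComp os) t o' := by
  refine (uncoordinated_parComp 𝕀 os hos).wString_iff_of_mEquiv (fun a => ?_) ?_ hst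
  · obtain ⟨i, hi⟩ := 𝕀.cover a
    exact ⟨i, hi, 𝕀.coClosed i a hi⟩
  · rintro a b ⟨i, ha, hb⟩
    exact ⟨i, hb, ha⟩

end MultipartyTesting
end

section
/- For every process p, set of observable names I, and string s ∈ Act*: if p↾I ⇒^s p'↾I, then there exists t ∈ ⟨s⟩_I such that p ⇒^t p'. -/
/-!
Common definitions: sequential CCS with success, configurations,
must testing, Mazurkiewicz traces, filtered traces, interfaces, and
the classical / uncoordinated / individualistic must preorders.
-/

namespace MultipartyTesting

variable {Name : Type}

theorem WString.of_wTau {c d c' : Conf Name} {s : List (Act Name)} (h : WTau c d)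
    (h' : WString d s c') : WString c s c' := by
  cases h' with
  | nil h₁ => exact .nil (h.trans h₁)
  | cons h₁ h₂ =>
    obtain ⟨c₁, c₂, h₃, h₄, h₅⟩ := h₁
    exact .cons ⟨c₁, c₂, h.trans h₃, h₄, h₅⟩ h₂

theorem WString.append {c d c' : Conf Name} {s t : List (Act Name)} (h : WString c s d)
    (h' : WString d t c') : WString c (s ++ t) c' := by
  induction h with
  | nil h₁ => exact h'.of_wTau h₁
  | cons h₁ _ ih => exact .cons h₁ (ih h')

theorem WString.of_step {c c' : Conf Name} {a : Act Name} (h : CStep c (Label.act a) c') :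
    WString c [a] c' :=
  .cons ⟨c, c', .refl, h, .refl⟩ (.nil .refl)

theorem fproj_append (V : Set (Act Name)) (s t : List (Act Name)) :
    fproj V (s ++ t) = fproj V s ++ fproj V t :=
  List.filter_append ..

theorem exists_wString_of_hide_step_tau {V : Set (Act Name)} {c d : Conf Name}
    (h : CStep (Conf.hide V c) Label.tau d) :
    ∃ c' t, d = Conf.hide V c' ∧ fproj V t = [] ∧ WString c t c' := by
  cases h with
  | @hideH _ _ a c' h ha => exact ⟨c', [a], rfl, by simp [fproj, ha], .of_step h⟩
  | @hideT _ _ c' h => exact ⟨c', [], rfl, rfl, .nil (.single h)⟩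

theorem exists_wString_of_hide_wTau {V : Set (Act Name)} {c d : Conf Name}
    (h : WTau (Conf.hide V c) d) :
    ∃ c' t, d = Conf.hide V c' ∧ fproj V t = [] ∧ WString c t c' := by
  induction h with
  | refl => exact ⟨c, [], rfl, rfl, .nil .refl⟩
  | tail _ h ih =>
    obtain ⟨c₁, t₁, rfl, ht₁, h₁⟩ := ih
    obtain ⟨c₂, t₂, rfl, ht₂, h₂⟩ := exists_wString_of_hide_step_tau h
    exact ⟨c₂, t₁ ++ t₂, rfl, by simp [fproj_append, ht₁, ht₂], h₁.append h₂⟩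

theorem exists_wString_of_hide_wAct {V : Set (Act Name)} {c d : Conf Name} {a : Act Name}
    (h : WAct (Conf.hide V c) a d) :
    ∃ c' t, d = Conf.hide V c' ∧ fproj V t = fproj V [a] ∧ WString c t c' := by
  obtain ⟨_, _, h₁, h₂, h₃⟩ := h
  obtain ⟨c₁, t₁, rfl, ht₁, h₁⟩ := exists_wString_of_hide_wTau h₁
  cases h₂ with
  | hideV h₂ _ =>
    obtain ⟨c₃, t₃, rfl, ht₃, h₃⟩ := exists_wString_of_hide_wTau h₃
    exact ⟨c₃, t₁ ++ ([a] ++ t₃), rfl, by simp only [fproj_append, ht₁, ht₃, List.nil_append,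
      List.append_nil], h₁.append ((WString.of_step h₂).append h₃)⟩

theorem exists_wString_of_hide_wString {V : Set (Act Name)} {c d : Conf Name}
    {s : List (Act Name)} (h : WString (Conf.hide V c) s d) :
    ∃ c' t, d = Conf.hide V c' ∧ fproj V t = fproj V s ∧ WString c t c' := by
  generalize hx : Conf.hide V c = x at h
  induction h generalizing c with
  | nil h => exact exists_wString_of_hide_wTau (hx ▸ h)
  | @cons _ a _ s _ h _ ih =>
    subst hx
    obtain ⟨c₁, t₁, rfl, ht₁, h₁⟩ := exists_wString_of_hide_wAct h
    obtain ⟨c₂, t₂, rfl, ht₂, h₂⟩ := ih rfl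
    exact ⟨c₂, t₁ ++ t₂, rfl, by rw [fproj_append, ht₁, ht₂, ← fproj_append, List.singleton_append],
      h₁.append h₂⟩

/-- if `p↾V ⇒^s p'↾V` then there exists `t ∈ ⟨s⟩_V` with `p ⇒^t p'`. -/
theorem hide_wstring_rec (Name : Type) [Countable Name]
    (V : Set (Act Name)) (hV : ∀ a ∈ V, Act.co a ∈ V)
    (p p' : Proc Name) (s : List (Act Name))
    (h : WString (Conf.hide V (Conf.proc p)) s (Conf.hide V (Conf.proc p'))) :
    ∃ t, fproj V t = fproj V s ∧ WString (Conf.proc p) t (Conf.proc p') := by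
  obtain ⟨c', t, hc, ht, hw⟩ := exists_wString_of_hide_wString h
  cases hc
  exact ⟨t, ht, hw⟩

end MultipartyTesting
end
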